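/- Let L/K be a finite Galois extension of complete discrete valuation fields with perfect residue fields, let M be the subfield of L fixed by Gal(L/K)^{(u_{L/K})}, and let E be an algebraic extension of K. Then the following are equivalent: (1) there exists an O_K-algebra homomorphism O_L → O_E/a_{E/K}^{u_{L/K}}; (2) M is contained in E and there exists an O_M-algebra homomorphism O_L → O_E/a_{E/M}^{u_{L/M}}. -/

import Mathlib

noncomputable section

open scoped Classical

set_option synthInstance.maxHeartbeats 400000

namespace Fontaine

/-! ### The ambient setting

`K` is a field, `Ω` a fixed algebraic closure of `K`, and `v : Ω → ℝ` is (the unique)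
additive valuation on `Ω` extending the normalized discrete valuation of `K`
(so that `v (K^×) = ℤ`), with `K` complete.  Algebraic extensions `E / K` are
intermediate fields of `Ω / K`. -/

/-- `v` is an additive valuation on `Ω`, extending the normalized discrete valuation
of the complete field `K` (the value of `v` at `0` is irrelevant junk). The
Galois-invariance and completeness clauses are true (and uniquely determining)
properties of this situation. -/
structure IsCDV (K Ω : Type) [Field K] [Field Ω] [Algebra K Ω] (v : Ω → ℝ) : Prop where
  map_mul : ∀ x y : Ω, x ≠ 0 → y ≠ 0 → v (x * y) = v x + v y
  add_ge : ∀ x y : Ω, x ≠ 0 → y ≠ 0 → x + y ≠ 0 → min (v x) (v y) ≤ v (x + y)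
  int_valued : ∀ x : K, x ≠ 0 → ∃ n : ℤ, v (algebraMap K Ω x) = (n : ℝ)
  exists_uniformizer : ∃ x : K, v (algebraMap K Ω x) = 1
  galois_inv : ∀ (E : IntermediateField K Ω) (σ : ↥E ≃ₐ[K] ↥E) (x : ↥E),
    v ((σ x : Ω)) = v (x : Ω)
  complete : ∀ x : ℕ → K,
    (∀ N : ℝ, ∃ n₀ : ℕ, ∀ i j : ℕ, n₀ ≤ i → n₀ ≤ j →
      x i = x j ∨ N ≤ v (algebraMap K Ω (x i - x j))) →
    ∃ y : K, ∀ N : ℝ, ∃ n₀ : ℕ, ∀ i : ℕ, n₀ ≤ i →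
      x i = y ∨ N ≤ v (algebraMap K Ω (x i - y))

variable {K Ω : Type} [Field K] [Field Ω] [Algebra K Ω] (v : Ω → ℝ)

/-- `x` belongs to the ring of integers `O_E` of `E`. -/
def IsInt (E : IntermediateField K Ω) (x : Ω) : Prop :=
  x ∈ E ∧ (x = 0 ∨ 0 ≤ v x)

/-- The minimal positive value of `v` on `F`; it equals `1 / e_{F/K}`. -/
def minVal (F : IntermediateField K Ω) : ℝ :=
  sInf {r : ℝ | 0 < r ∧ ∃ x ∈ F, v x = r}

/-- The ramification index `e_{F/K}`. -/
def ramIdx (F : IntermediateField K Ω) : ℝ := (minVal v F)⁻¹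

/-- The valuation normalized with respect to the base field `F`
(so that `vRel v F (F^×) = ℤ`); this is `v_F`. -/
def vRel (F : IntermediateField K Ω) (x : Ω) : ℝ := v x * ramIdx v F

/-- `x` lies in the ideal `a_{E/F}^m = {x ∈ O_E : v_F x ≥ m}` (valuation condition). -/
def InId (F : IntermediateField K Ω) (m : ℝ) (x : Ω) : Prop :=
  x = 0 ∨ m ≤ vRel v F x

/-- `f : Ω → Ω` is a set-theoretic representative of an `O_F`-algebra homomorphism
`O_L → O_E / a_{E/F}^m`. -/
def IsHomMod (F L E : IntermediateField K Ω) (m : ℝ) (f : Ω → Ω) : Prop :=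
  (∀ x, IsInt v L x → IsInt v E (f x)) ∧
  (∀ x y, IsInt v L x → IsInt v L y → InId v F m (f (x + y) - (f x + f y))) ∧
  (∀ x y, IsInt v L x → IsInt v L y → InId v F m (f (x * y) - f x * f y)) ∧
  InId v F m (f 1 - 1) ∧
  (∀ c, IsInt v F c → InId v F m (f c - c))

/-- There exists an `O_F`-algebra homomorphism `O_L → O_E / a_{E/F}^m`. -/
def HomMod (F L E : IntermediateField K Ω) (m : ℝ) : Prop :=
  ∃ f : Ω → Ω, IsHomMod v F L E m f

/-- Fontaine's property (P_m) for the extension `L / F`. -/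
def PropP (F L : IntermediateField K Ω) (m : ℝ) : Prop :=
  ∀ E : IntermediateField K Ω, F ≤ E → HomMod v F L E m → L ≤ E

/-- `E / F` is totally ramified: the residue extension is trivial. -/
def TotRam (F E : IntermediateField K Ω) : Prop :=
  ∀ x, IsInt v E x → ∃ c, c ∈ F ∧ (c = 0 ∨ 0 ≤ v c) ∧ (x - c = 0 ∨ 0 < v (x - c))

/-- Property (P_m^tr) for `L / F`: (P_m) restricted to totally ramified `E / F`. -/
def PropPtr (F L : IntermediateField K Ω) (m : ℝ) : Prop :=
  ∀ E : IntermediateField K Ω, F ≤ E → TotRam v F E → HomMod v F L E m → L ≤ E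

/-- `E / F` is unramified: `F ≤ E` and the value group does not grow
(the residue fields being perfect, this is the usual notion). -/
def Unram (F E : IntermediateField K Ω) : Prop :=
  F ≤ E ∧ ∀ x : Ω, x ∈ E → x ≠ 0 → ∃ n : ℤ, vRel v F x = (n : ℝ)

/-- The elements of `Gal(L/K)` fixing `F` pointwise, i.e. `Gal(L/F)`. -/
def relGal (F L : IntermediateField K Ω) : Set (↥L ≃ₐ[K] ↥L) :=
  {σ | ∀ x : ↥L, (x : Ω) ∈ F → σ x = x}

/-- `σ` lies in the ramification group `Gal(L/F)_{(i)}` in Fontaine's lower numbering: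
`σ ∈ Gal(L/F)` and `v_F (σ x - x) ≥ i` for all integers `x` of `L`. -/
def lowerAt (F L : IntermediateField K Ω) (σ : ↥L ≃ₐ[K] ↥L) (i : ℝ) : Prop :=
  σ ∈ relGal F L ∧
    ∀ x : ↥L, IsInt v L (x : Ω) → (σ x = x ∨ i ≤ vRel v F ((σ x : Ω) - (x : Ω)))

/-- Fontaine's function `i_{L/F}(σ) = min_{x ∈ O_L} v_F (σ x - x)`. -/
def iFon (F L : IntermediateField K Ω) (σ : ↥L ≃ₐ[K] ↥L) : ℝ :=
  sSup {i : ℝ | lowerAt v F L σ i}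

/-- `i_{L/F}`: the largest `i` with `Gal(L/F)_{(i)}` nontrivial. -/
def iBreak (F L : IntermediateField K Ω) : ℝ :=
  sSup {i : ℝ | ∃ σ : ↥L ≃ₐ[K] ↥L, σ ≠ 1 ∧ lowerAt v F L σ i}

/-- Fontaine's Herbrand function `φ̃_{L/F}(t) = t + ∑_{1 ≠ σ ∈ Gal(L/F)} min (i_{L/F}(σ)) t`
(valid for `t ≥ 0` when the residue extension is separable). -/
def phiT (F L : IntermediateField K Ω) (t : ℝ) : ℝ :=
  t + ∑ᶠ σ ∈ {σ : ↥L ≃ₐ[K] ↥L | σ ∈ relGal F L ∧ σ ≠ 1}, min (iFon v F L σ) t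

/-- The maximal upper ramification break `u_{L/F} = φ̃_{L/F}(i_{L/F})`
(in Fontaine's numbering). -/
def uBreak (F L : IntermediateField K Ω) : ℝ := phiT v F L (iBreak v F L)

/-- Fontaine's inverse Herbrand function `ψ̃_{L/F}`. -/
def psiT (F L : IntermediateField K Ω) (u : ℝ) : ℝ :=
  sInf {t : ℝ | 0 ≤ t ∧ u ≤ phiT v F L t}

/-- Serre's inverse Herbrand function `ψ_{L/K}(u) = e_{L/K} ψ̃_{L/K}(u+1) - 1`. -/
def serrePsi (L : IntermediateField K Ω) (u : ℝ) : ℝ :=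
  ramIdx v L * psiT v ⊥ L (u + 1) - 1

/-- `L/K` has a unique jump in the ramification filtration of its Galois group:
`Gal(L/K)^{(u)} = Gal(L/K)` for all `u ≤ u_{L/K}`; equivalently, all
`i_{L/K}(σ)`, `σ ≠ 1`, are equal to `i_{L/K}`. -/
def UniqueJump (L : IntermediateField K Ω) : Prop :=
  ∀ σ : ↥L ≃ₐ[K] ↥L, σ ≠ 1 → iFon v ⊥ L σ = iBreak v ⊥ L

/-- The fixed field `M` of `Gal(L/K)^{(u_{L/K})} = Gal(L/K)_{(i_{L/K})}` inside `L`,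
as an intermediate field of `Ω / K`. -/
def ramFixed (L : IntermediateField K Ω) : IntermediateField K Ω where
  carrier := {x : Ω | ∃ hx : x ∈ L, ∀ σ : ↥L ≃ₐ[K] ↥L,
    lowerAt v ⊥ L σ (iBreak v ⊥ L) → σ ⟨x, hx⟩ = ⟨x, hx⟩}
  mul_mem' := by
    rintro a b ⟨ha, pa⟩ ⟨hb, pb⟩
    refine ⟨mul_mem ha hb, fun σ hσ => ?_⟩
    have h : (⟨a * b, mul_mem ha hb⟩ : ↥L) = ⟨a, ha⟩ * ⟨b, hb⟩ := rfl
    rw [h, map_mul, pa σ hσ, pb σ hσ]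
  one_mem' := by
    refine ⟨one_mem L, fun σ hσ => ?_⟩
    have h : (⟨(1 : Ω), one_mem L⟩ : ↥L) = 1 := rfl
    rw [h, map_one]
  add_mem' := by
    rintro a b ⟨ha, pa⟩ ⟨hb, pb⟩
    refine ⟨add_mem ha hb, fun σ hσ => ?_⟩
    have h : (⟨a + b, add_mem ha hb⟩ : ↥L) = ⟨a, ha⟩ + ⟨b, hb⟩ := rfl
    rw [h, map_add, pa σ hσ, pb σ hσ]
  zero_mem' := by
    refine ⟨zero_mem L, fun σ hσ => ?_⟩
    have h : (⟨(0 : Ω), zero_mem L⟩ : ↥L) = 0 := rfl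
    rw [h, map_zero]
  algebraMap_mem' := by
    intro r
    refine ⟨IntermediateField.algebraMap_mem L r, fun σ hσ => ?_⟩
    have h : (⟨algebraMap K Ω r, IntermediateField.algebraMap_mem L r⟩ : ↥L)
        = algebraMap K ↥L r := rfl
    rw [h, AlgEquiv.commutes]
  inv_mem' := by
    rintro a ⟨ha, pa⟩
    refine ⟨IntermediateField.inv_mem L ha, fun σ hσ => ?_⟩
    have h : (⟨a⁻¹, IntermediateField.inv_mem L ha⟩ : ↥L) = (⟨a, ha⟩ : ↥L)⁻¹ := by
      apply Subtype.ext
      rw [IntermediateField.coe_inv]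
    rw [h, map_inv₀, pa σ hσ]

section Res

variable {Ω : Type} [Field Ω] (v : Ω → ℝ) (K : Type) [Field K] [Algebra K Ω]

/-- `x ∈ K` is an integer of `K`. -/
def IsIntK (x : K) : Prop := x = 0 ∨ 0 ≤ v (algebraMap K Ω x)

/-- The residue field of `K` has characteristic `p`. -/
def ResidueCharP (p : ℕ) : Prop :=
  (p : K) = 0 ∨ 0 < v (algebraMap K Ω (p : K))

/-- The Frobenius of the residue field of `K` at `p` is surjective. -/
def PerfectResidueAt (p : ℕ) : Prop :=
  ∀ x : K, IsIntK v K x → ∃ y : K, IsIntK v K y ∧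
    (x - y ^ p = 0 ∨ 0 < v (algebraMap K Ω (x - y ^ p)))

/-- The residue field of `K` is perfect. -/
def PerfectResidue : Prop :=
  ∀ p : ℕ, p.Prime → ResidueCharP v K p → PerfectResidueAt v K p

/-- The residue field of `K` is algebraically closed. -/
def ResidueAlgClosed : Prop :=
  ∀ q : Polynomial K, q.Monic → 0 < q.natDegree → (∀ i, IsIntK v K (q.coeff i)) →
    ∃ x : K, IsIntK v K x ∧
      (Polynomial.eval x q = 0 ∨ 0 < v (algebraMap K Ω (Polynomial.eval x q)))

/-- `ρ : K → k` realizes `k` as the residue field of `K`: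
on the integers of `K` it is the residue (reduction) map. -/
def IsResidueMap {k : Type} [Field k] (ρ : K → k) : Prop :=
  (∀ x y : K, IsIntK v K x → IsIntK v K y → ρ (x + y) = ρ x + ρ y) ∧
  (∀ x y : K, IsIntK v K x → IsIntK v K y → ρ (x * y) = ρ x * ρ y) ∧
  ρ 1 = 1 ∧
  (∀ a : k, ∃ x : K, IsIntK v K x ∧ ρ x = a) ∧
  (∀ x : K, IsIntK v K x → (ρ x = 0 ↔ (x = 0 ∨ 0 < v (algebraMap K Ω x))))

/-- The group `U_K^n` of `n`-th principal units of `K` (for `n ≥ 1`),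
as a subgroup of `Kˣ`. -/
def prinK (n : ℝ) : Subgroup Kˣ :=
  Subgroup.closure {u : Kˣ | (u : K) = 1 ∨ n ≤ v (algebraMap K Ω ((u : K) - 1))}

end Res

/-- The group `U_E^n` of `n`-th principal units of an intermediate field `E`
(for `n ≥ 1`), with respect to the normalized valuation `v_E` of `E`,
as a subgroup of `(↥E)ˣ`. -/
def prinE {K Ω : Type} [Field K] [Field Ω] [Algebra K Ω] (v : Ω → ℝ)
    (E : IntermediateField K Ω) (n : ℝ) : Subgroup (↥E)ˣ :=
  Subgroup.closure {u : (↥E)ˣ | ((u : ↥E) : Ω) = 1 ∨ n ≤ vRel v E (((u : ↥E) : Ω) - 1)}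

end Fontaine

open Fontaine

section
open Polynomial IsLocalRing

/-- If `g(α)` generates the maximal ideal of `B` and `α` generates the residue extension, then
`α` generates `B`. -/
theorem adjoin_eq_top_of_residue {A B : Type*} [CommRing A] [IsLocalRing A] [CommRing B]
    [IsLocalRing B] [Algebra A B] [Module.Finite A B] (α : B) (g : A[X])
    (hg : maximalIdeal B = Ideal.span {aeval α g})
    (hres : ∀ x : B, ∃ p : A[X], x - aeval α p ∈ maximalIdeal B) :
    Algebra.adjoin A {α} = ⊤ := by
  set S := Algebra.adjoin A {α} with hS
  have hint : Algebra.IsIntegral A B := inferInstance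
  have hfin : Module.Finite S B := Module.Finite.of_restrictScalars_finite A S B
  have hintS : Algebra.IsIntegral S B := inferInstance
  have hfaith : FaithfulSMul S B := (faithfulSMul_iff_algebraMap_injective S B).2
    Subtype.val_injective
  have hloc : IsLocalHom (algebraMap S B) := inferInstance
  have hS' : IsLocalRing S := RingHom.domain_isLocalRing (algebraMap S B)
  have hmem : ∀ p : A[X], aeval α p ∈ S := fun p => aeval_mem_adjoin_singleton A α
  have hle : (⊤ : Submodule S B) ≤ 1 := by
    refine Submodule.le_of_le_smul_of_le_jacobson_bot (I := maximalIdeal S)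
      Module.Finite.fg_top (maximalIdeal_le_jacobson _) ?_
    intro x _
    obtain ⟨p, hp⟩ := hres x
    rw [hg, Ideal.mem_span_singleton'] at hp
    obtain ⟨y, hy⟩ := hp
    have hx : x = aeval α p + (⟨aeval α g, hmem g⟩ : S) • y := by
      rw [Algebra.smul_def]
      change x = aeval α p + aeval α g * y
      linear_combination -hy
    rw [hx]
    refine Submodule.add_mem_sup ?_ (Submodule.smul_mem_smul ?_ trivial)
    · exact Submodule.mem_one.2 ⟨⟨aeval α p, hmem p⟩, rfl⟩
    · rw [mem_maximalIdeal, mem_nonunits_iff]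
      intro hu
      have := hu.map (algebraMap S B)
      have h2 : aeval α g ∈ maximalIdeal B := hg ▸ Ideal.mem_span_singleton_self _
      exact h2 this
  refine eq_top_iff.2 fun x _ => ?_
  obtain ⟨s, hs⟩ := Submodule.mem_one.1 (hle (trivial : x ∈ ⊤))
  rw [← hs]
  exact s.2

theorem exists_adjoin_singleton_eq_top {A B : Type*} [CommRing A] [IsLocalRing A] [CommRing B]
    [IsLocalRing B] [Algebra A B] [FaithfulSMul A B] [Module.Finite A B]
    [PerfectField (ResidueField A)] (hB : (maximalIdeal B).IsPrincipal) :
    ∃ α : B, Algebra.adjoin A {α} = ⊤ := by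
  have hint : Algebra.IsIntegral A B := inferInstance
  have hloc : IsLocalHom (algebraMap A B) := inferInstance
  have hfin : Module.Finite (ResidueField A) (ResidueField B) := inferInstance
  obtain ⟨a, ha⟩ := Field.exists_primitive_element (ResidueField A) (ResidueField B)
  obtain ⟨g, hg⟩ := map_surjective (residue A) (residue_surjective (R := A))
    (minpoly (ResidueField A) a)
  have hred : ∀ (x : B) (p : A[X]),
      residue B (aeval x p) = aeval (residue B x) (p.map (residue A)) := by
    intro x p
    rw [aeval_def, hom_eval₂, aeval_def, eval₂_map]
    rfl
  have hroot : ∀ x : B, residue B x = a → aeval x g ∈ maximalIdeal B := by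
    intro x hx
    rw [← residue_eq_zero_iff, hred, hx, hg, minpoly.aeval]
  have hgen : ∀ x : B, residue B x = a → ∀ y : B, ∃ p : A[X], y - aeval x p ∈ maximalIdeal B := by
    intro x hx y
    have hy : residue B y ∈ Algebra.adjoin (ResidueField A) {a} := by
      rw [← IntermediateField.adjoin_simple_toSubalgebra_of_isAlgebraic
        (Algebra.IsAlgebraic.isAlgebraic a), ha]
      trivial
    obtain ⟨q, hq⟩ := Algebra.adjoin_singleton_eq_range_aeval (ResidueField A) a ▸ hy
    obtain ⟨p, rfl⟩ := map_surjective (residue A) (residue_surjective (R := A)) q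
    refine ⟨p, ?_⟩
    rw [← residue_eq_zero_iff, map_sub, hred, hx, sub_eq_zero]
    exact hq.symm
  obtain ⟨α, hα⟩ := residue_surjective a
  have hder : IsUnit (aeval α (derivative g)) := by
    rw [← residue_ne_zero_iff_isUnit, hred, hα, ← derivative_map, hg]
    exact (Algebra.IsSeparable.isSeparable (ResidueField A) a).aeval_derivative_ne_zero
      (minpoly.aeval _ _)
  obtain ⟨w, hw⟩ := hB
  rw [Ideal.submodule_span_eq] at hw
  have hwm : w ∈ maximalIdeal B := hw ▸ Ideal.mem_span_singleton_self w
  have key : ∀ x u : B, aeval x g = w * u → IsUnit u →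
      maximalIdeal B = Ideal.span {aeval x g} := by
    intro x u hx hu
    rw [hw, hx, Ideal.span_singleton_mul_right_unit hu]
  obtain ⟨u, hu⟩ := Ideal.mem_span_singleton'.1 (hw ▸ hroot α hα)
  by_cases hunit : IsUnit u
  · exact ⟨α, adjoin_eq_top_of_residue α g (key α u (by rw [← hu, mul_comm]) hunit)
      (hgen α hα)⟩
  have hα' : residue B (α + w) = a := by
    rw [map_add, hα, (residue_eq_zero_iff w).2 hwm, add_zero]
  refine ⟨α + w, adjoin_eq_top_of_residue (α + w) g ?_ (hgen _ hα')⟩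
  obtain ⟨t, ht⟩ := (g.map (algebraMap A B)).binomExpansion α w
  simp only [eval_map_algebraMap, derivative_map] at ht
  refine key _ (aeval α (derivative g) + (u + t * w)) (by rw [ht, ← hu]; ring) ?_
  rw [← residue_ne_zero_iff_isUnit, map_add, (residue_eq_zero_iff (u + t * w)).2, add_zero]
  · exact (residue_ne_zero_iff_isUnit _).2 hder
  · exact add_mem hunit (Ideal.mul_mem_left _ _ hwm)

end

namespace Fontaine

variable {K Ω : Type} [Field K] [Field Ω] [Algebra K Ω] {v : Ω → ℝ}

/-- `v x ≥ m`, with the convention `v 0 = ∞`. -/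
def ValGe (v : Ω → ℝ) (m : ℝ) (x : Ω) : Prop := x = 0 ∨ m ≤ v x

theorem ValGe.mono {m n : ℝ} {x : Ω} (h : ValGe v m x) (hnm : n ≤ m) : ValGe v n x :=
  h.imp_right hnm.trans

theorem ValGe.le {m : ℝ} {x : Ω} (h : ValGe v m x) (hx : x ≠ 0) : m ≤ v x :=
  h.resolve_left hx

namespace IsCDV

theorem map_one (hv : IsCDV K Ω v) : v 1 = 0 := by
  have := hv.map_mul 1 1 one_ne_zero one_ne_zero
  rw [mul_one] at this
  linarith

theorem map_neg (hv : IsCDV K Ω v) (x : Ω) : v (-x) = v x := by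
  rcases eq_or_ne x 0 with rfl | hx
  · rw [neg_zero]
  have h1 : v (-1) = 0 := by
    have := hv.map_mul (-1) (-1) (by simp) (by simp)
    rw [neg_mul_neg, mul_one, hv.map_one] at this
    linarith
  rw [neg_eq_neg_one_mul, hv.map_mul _ _ (by simp) hx, h1, zero_add]

theorem map_inv (hv : IsCDV K Ω v) {x : Ω} (hx : x ≠ 0) : v x⁻¹ = - v x := by
  have := hv.map_mul x x⁻¹ hx (inv_ne_zero hx)
  rw [mul_inv_cancel₀ hx, hv.map_one] at this
  linarith

theorem map_prod (hv : IsCDV K Ω v) {ι : Type*} (s : Finset ι) (f : ι → Ω)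
    (hf : ∀ i ∈ s, f i ≠ 0) : v (∏ i ∈ s, f i) = ∑ i ∈ s, v (f i) := by
  induction s using Finset.induction_on with
  | empty => simpa using hv.map_one
  | insert a s ha ih =>
    have hs : ∀ i ∈ s, f i ≠ 0 := fun i hi => hf i (Finset.mem_insert_of_mem hi)
    rw [Finset.prod_insert ha, Finset.sum_insert ha,
      hv.map_mul _ _ (hf a (Finset.mem_insert_self a s)) (Finset.prod_ne_zero_iff.2 hs), ih hs]

theorem valGe_add (hv : IsCDV K Ω v) {m : ℝ} {x y : Ω} (hx : ValGe v m x) (hy : ValGe v m y) :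
    ValGe v m (x + y) := by
  rcases eq_or_ne x 0 with rfl | hx0
  · rwa [zero_add]
  rcases eq_or_ne y 0 with rfl | hy0
  · rwa [add_zero]
  by_cases h : x + y = 0
  · exact Or.inl h
  · exact Or.inr ((le_min (hx.le hx0) (hy.le hy0)).trans (hv.add_ge x y hx0 hy0 h))

theorem valGe_neg (hv : IsCDV K Ω v) {m : ℝ} {x : Ω} (hx : ValGe v m x) : ValGe v m (-x) :=
  hx.imp neg_eq_zero.2 fun h => by rwa [hv.map_neg]

theorem valGe_sub (hv : IsCDV K Ω v) {m : ℝ} {x y : Ω} (hx : ValGe v m x) (hy : ValGe v m y) :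
    ValGe v m (x - y) :=
  sub_eq_add_neg x y ▸ hv.valGe_add hx (hv.valGe_neg hy)

theorem valGe_mul (hv : IsCDV K Ω v) {m n : ℝ} {x y : Ω} (hx : ValGe v m x)
    (hy : ValGe v n y) : ValGe v (m + n) (x * y) := by
  rcases eq_or_ne x 0 with rfl | hx0
  · exact Or.inl (zero_mul y)
  rcases eq_or_ne y 0 with rfl | hy0
  · exact Or.inl (mul_zero x)
  · right
    rw [hv.map_mul x y hx0 hy0]
    exact add_le_add (hx.le hx0) (hy.le hy0)

theorem valGe_mul_left (hv : IsCDV K Ω v) {m : ℝ} {x y : Ω} (hx : ValGe v 0 x)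
    (hy : ValGe v m y) : ValGe v m (x * y) :=
  (hv.valGe_mul hx hy).mono (zero_add m).ge

theorem valGe_one (hv : IsCDV K Ω v) : ValGe v 0 (1 : Ω) := Or.inr hv.map_one.ge

theorem valGe_prod (hv : IsCDV K Ω v) {ι : Type*} (s : Finset ι) (f : ι → Ω) (m : ι → ℝ)
    (hf : ∀ i ∈ s, ValGe v (m i) (f i)) : ValGe v (∑ i ∈ s, m i) (∏ i ∈ s, f i) := by
  by_cases h : ∀ i ∈ s, f i ≠ 0
  · right
    rw [hv.map_prod s f h]
    exact Finset.sum_le_sum fun i hi => (hf i hi).le (h i hi)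
  · push Not at h
    obtain ⟨i, hi, h0⟩ := h
    exact Or.inl (Finset.prod_eq_zero hi h0)

/-- The valuation ring of a field embedded in `Ω`. -/
def intRing (hv : IsCDV K Ω v) {F : Type} [Field F] (φ : F →+* Ω) : ValuationSubring F where
  carrier := {x | ValGe v 0 (φ x)}
  mul_mem' {x y} hx hy := by
    simpa using hv.valGe_mul_left hx hy
  one_mem' := by simpa using hv.valGe_one
  add_mem' {x y} hx hy := by
    simpa using hv.valGe_add hx hy
  zero_mem' := Or.inl φ.map_zero
  neg_mem' {x} hx := by
    simpa using hv.valGe_neg hx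
  mem_or_inv_mem' x := by
    rcases eq_or_ne x 0 with rfl | hx
    · exact Or.inl (Or.inl φ.map_zero)
    have hφ : φ x ≠ 0 := (map_ne_zero φ).2 hx
    rcases le_total 0 (v (φ x)) with h | h
    · exact Or.inl (Or.inr h)
    · refine Or.inr (Or.inr ?_)
      rw [map_inv₀, hv.map_inv hφ]
      linarith

theorem mem_intRing (hv : IsCDV K Ω v) {F : Type} [Field F] (φ : F →+* Ω) {x : F} :
    x ∈ hv.intRing φ ↔ ValGe v 0 (φ x) := Iff.rfl

theorem isPrincipalIdealRing_intRing (hv : IsCDV K Ω v) {F : Type} [Field F] (φ : F →+* Ω)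
    (n : ℝ) (hn : 0 < n) (hint : ∀ x : F, x ≠ 0 → ∃ z : ℤ, n * v (φ x) = z) :
    IsPrincipalIdealRing (hv.intRing φ) := by
  have hnat : ∀ x : hv.intRing φ, x ≠ 0 → ∃ k : ℕ, n * v (φ x) = k := by
    intro x hx
    have hx' : (x : F) ≠ 0 := fun h => hx (Subtype.ext h)
    obtain ⟨z, hz⟩ := hint x hx'
    have h0 : 0 ≤ v (φ x) := ValGe.le x.2 ((map_ne_zero φ).2 hx')
    have hz0 : 0 ≤ z := by
      have : (0 : ℝ) ≤ z := hz ▸ mul_nonneg hn.le h0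
      exact_mod_cast this
    lift z to ℕ using hz0
    exact ⟨z, by simpa using hz⟩
  refine ⟨fun I => ?_⟩
  rcases eq_or_ne I ⊥ with rfl | hI
  · exact bot_isPrincipal
  obtain ⟨x₀, hx₀, hx₀0⟩ := Submodule.exists_mem_ne_zero_of_ne_bot hI
  have hex : ∃ k : ℕ, ∃ x ∈ I, x ≠ 0 ∧ n * v (φ x) = k :=
    (hnat x₀ hx₀0).imp fun k hk => ⟨x₀, hx₀, hx₀0, hk⟩
  obtain ⟨x, hxI, hx0, hxk⟩ := Nat.find_spec hex
  refine ⟨x, le_antisymm (fun y hy => ?_) ((Ideal.span_singleton_le_iff_mem I).2 hxI)⟩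
  rw [Ideal.submodule_span_eq, Ideal.mem_span_singleton]
  rcases eq_or_ne y 0 with rfl | hy0
  · exact dvd_zero x
  obtain ⟨k, hk⟩ := hnat y hy0
  have hle : (Nat.find hex : ℝ) ≤ k := by
    exact_mod_cast Nat.find_min' hex ⟨y, hy, hy0, hk⟩
  have hxF : (x : F) ≠ 0 := fun h => hx0 (Subtype.ext h)
  have hyF : (y : F) ≠ 0 := fun h => hy0 (Subtype.ext h)
  have hφx := (map_ne_zero φ).2 hxF
  have hφy := (map_ne_zero φ).2 hyF
  refine ⟨⟨y * (x : F)⁻¹, Or.inr ?_⟩, Subtype.ext ?_⟩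
  · rw [_root_.map_mul, map_inv₀, hv.map_mul _ _ hφy (inv_ne_zero hφx), hv.map_inv hφx]
    have : v (φ x) ≤ v (φ y) := le_of_mul_le_mul_left (by rw [hxk, hk]; exact hle) hn
    linarith
  · change (y : F) = x * (y * (x : F)⁻¹)
    field_simp

theorem mem_maximalIdeal_intRing (hv : IsCDV K Ω v) {F : Type} [Field F] (φ : F →+* Ω)
    (x : hv.intRing φ) :
    x ∈ IsLocalRing.maximalIdeal (hv.intRing φ) ↔ φ x = 0 ∨ 0 < v (φ x) := by
  rcases eq_or_ne x 0 with rfl | hx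
  · simp
  have hxF : (x : F) ≠ 0 := fun h => hx (Subtype.ext h)
  have hφx := (map_ne_zero φ).2 hxF
  have hx0 : 0 ≤ v (φ x) := ValGe.le x.2 hφx
  rw [IsLocalRing.mem_maximalIdeal, mem_nonunits_iff, or_iff_right hφx,
    ← not_le, not_iff_not]
  constructor
  · rintro ⟨u, rfl⟩
    have h1 : ((u⁻¹ : (hv.intRing φ)ˣ) : F) = ((u : hv.intRing φ) : F)⁻¹ := by
      apply eq_inv_of_mul_eq_one_left
      exact_mod_cast congrArg Subtype.val u.inv_mul
    have h2 : ValGe v 0 (φ ((u⁻¹ : (hv.intRing φ)ˣ) : hv.intRing φ)) :=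
      ((u⁻¹ : (hv.intRing φ)ˣ) : hv.intRing φ).2
    rw [h1, map_inv₀] at h2
    have := h2.le (inv_ne_zero hφx)
    rw [hv.map_inv hφx] at this
    linarith
  · intro h
    refine IsUnit.of_mul_eq_one ⟨(x : F)⁻¹, Or.inr ?_⟩ (Subtype.ext ?_)
    · rw [map_inv₀, hv.map_inv hφx]
      linarith
    · exact mul_inv_cancel₀ hxF

theorem perfectField_residueField (hv : IsCDV K Ω v) (hperf : PerfectResidue v K) :
    PerfectField (IsLocalRing.ResidueField (hv.intRing (algebraMap K Ω))) := by
  set A := hv.intRing (algebraMap K Ω)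
  obtain ⟨p, hp⟩ := CharP.exists (IsLocalRing.ResidueField A)
  rcases CharP.char_is_prime_or_zero (IsLocalRing.ResidueField A) p with hprime | rfl
  · have hfact : Fact p.Prime := ⟨hprime⟩
    have hpA : (p : A) ∈ IsLocalRing.maximalIdeal A := by
      rw [← IsLocalRing.residue_eq_zero_iff, map_natCast, CharP.cast_eq_zero]
    have hres : ResidueCharP v K p := by
      have := (hv.mem_maximalIdeal_intRing (algebraMap K Ω) (p : A)).1 hpA
      refine this.imp (fun h => ?_) fun h => ?_
      · simpa using (map_eq_zero (algebraMap K Ω)).1 h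
      · simpa using h
    have hpr : PerfectRing (IsLocalRing.ResidueField A) p := by
      refine PerfectRing.ofSurjective _ p fun a => ?_
      obtain ⟨x, rfl⟩ := IsLocalRing.residue_surjective a
      have hx : IsIntK v K x := by
        have : ValGe v 0 (algebraMap K Ω x) := x.2
        exact this.imp_left fun h => (map_eq_zero _).1 h
      obtain ⟨y, hy, hxy⟩ := hperf p hprime hres x hx
      have hyA : y ∈ A := by
        refine Or.imp_left (fun h => ?_) hy
        rw [h, map_zero]
      refine ⟨IsLocalRing.residue A ⟨y, hyA⟩, ?_⟩
      rw [frobenius_def, ← map_pow, eq_comm, ← sub_eq_zero, ← map_sub,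
        IsLocalRing.residue_eq_zero_iff, mem_maximalIdeal_intRing]
      refine Or.imp (fun h => ?_) id hxy
      change algebraMap K Ω (x - y ^ p) = 0
      rw [h, map_zero]
    exact PerfectRing.toPerfectField _ p
  · have := CharP.charP_to_charZero (IsLocalRing.ResidueField A)
    infer_instance

end IsCDV

end Fontaine

namespace Fontaine

open Polynomial

variable {K Ω : Type} [Field K] [Field Ω] [Algebra K Ω] {v : Ω → ℝ}

/-- The subgroup `Gal(L/F)` of `Gal(L/K)`. -/
def relSubgroup (F L : IntermediateField K Ω) : Subgroup (↥L ≃ₐ[K] ↥L) where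
  carrier := relGal F L
  mul_mem' {σ τ} hσ hτ x hx := by rw [AlgEquiv.mul_apply, hτ x hx, hσ x hx]
  one_mem' _ _ := rfl
  inv_mem' {σ} hσ x hx := by
    conv_lhs => rw [← hσ x hx]
    exact σ.symm_apply_apply x

theorem mem_of_relGal_fixed {F L : IntermediateField K Ω} [FiniteDimensional K ↥L] [IsGalois K ↥L]
    (hFL : F ≤ L) (x : ↥L) (hx : ∀ σ ∈ relGal F L, σ x = x) : (x : Ω) ∈ F := by
  have h := IsGalois.fixedField_fixingSubgroup (IntermediateField.restrict hFL)
  have hmem : x ∈ IntermediateField.fixedField (IntermediateField.restrict hFL).fixingSubgroup := by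
    rintro ⟨σ, hσ⟩
    refine hx σ fun y hy => ?_
    exact hσ ⟨y, (IntermediateField.mem_restrict hFL y).2 hy⟩
  rw [h] at hmem
  exact (IntermediateField.mem_restrict hFL x).1 hmem

/-- The characteristic polynomial `∏_{σ ∈ Gal(L/F)} (X - σ α)`. -/
def relCharpoly (F L : IntermediateField K Ω) [FiniteDimensional K ↥L] (α : ↥L) : Polynomial Ω :=
  ∏ σ : relSubgroup F L, (X - C ((σ.1 α : ↥L) : Ω))

section

variable {F L : IntermediateField K Ω} [FiniteDimensional K ↥L]

theorem monic_relCharpoly (α : ↥L) : (relCharpoly F L α).Monic :=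
  monic_prod_of_monic _ _ fun _ _ => monic_X_sub_C _

theorem eval_relCharpoly (α : ↥L) (β : Ω) :
    (relCharpoly F L α).eval β = ∏ σ : relSubgroup F L, (β - ((σ.1 α : ↥L) : Ω)) := by
  simp [relCharpoly, eval_prod]

theorem eval_self_relCharpoly (α : ↥L) : (relCharpoly F L α).eval (α : Ω) = 0 := by
  rw [eval_relCharpoly]
  exact Finset.prod_eq_zero (Finset.mem_univ 1) (sub_self _)

theorem coeff_relCharpoly_mem [IsGalois K ↥L] (hFL : F ≤ L) (α : ↥L) (i : ℕ) :
    (relCharpoly F L α).coeff i ∈ F := by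
  have h : relCharpoly F L α =
      (MulSemiringAction.charpoly (relSubgroup F L) α).map (algebraMap ↥L Ω) := by
    rw [MulSemiringAction.charpoly_eq, Polynomial.map_prod]
    refine Finset.prod_congr rfl fun σ _ => ?_
    rw [Polynomial.map_sub, map_X, map_C]
    rfl
  rw [h, coeff_map]
  exact mem_of_relGal_fixed hFL _ fun σ hσ =>
    MulSemiringAction.smul_coeff_charpoly α i (⟨σ, hσ⟩ : relSubgroup F L)

theorem IsCDV.map_galois {L : IntermediateField K Ω} (hv : IsCDV K Ω v) (σ : ↥L ≃ₐ[K] ↥L) (x : ↥L) :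
    v (σ x : Ω) = v (x : Ω) := hv.galois_inv L σ x

theorem IsCDV.valGe_galois {L : IntermediateField K Ω} (hv : IsCDV K Ω v) (σ : ↥L ≃ₐ[K] ↥L) {m : ℝ} {x : ↥L}
    (hx : ValGe v m (x : Ω)) : ValGe v m (σ x : Ω) := by
  rcases hx with hx | hx
  · left
    rw [ZeroMemClass.coe_eq_zero] at hx ⊢
    rw [hx, map_zero]
  · right
    rwa [hv.map_galois]

theorem IsCDV.valGe_coeff_relCharpoly (hv : IsCDV K Ω v) {α : ↥L} (hα : ValGe v 0 (α : Ω))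
    (i : ℕ) : ValGe v 0 ((relCharpoly F L α).coeff i) := by
  have hlift : relCharpoly F L α ∈ liftsRing (hv.intRing (RingHom.id Ω)).subtype := by
    refine Subring.prod_mem _ fun σ _ => Subring.sub_mem _ ?_ ?_
    · exact X_mem_lifts _
    · exact C_mem_lifts _ (⟨_, hv.valGe_galois σ.1 hα⟩ : hv.intRing (RingHom.id Ω))
  obtain ⟨y, hy⟩ := (lifts_iff_coeff_lifts _).1 hlift i
  rw [← hy]
  exact y.2

end

/-- `α` generates the ring of integers of `L` over the ring of integers of `K`. -/
def IsGenerator (v : Ω → ℝ) (L : IntermediateField K Ω) (α : ↥L) : Prop :=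
  ValGe v 0 (α : Ω) ∧ ∀ x : ↥L, ValGe v 0 (x : Ω) →
    ∃ p : K[X], (∀ i, ValGe v 0 (algebraMap K Ω (p.coeff i))) ∧ aeval α p = x

theorem IsCDV.exists_int_mul (hv : IsCDV K Ω v) (L : IntermediateField K Ω)
    [FiniteDimensional K ↥L] [IsGalois K ↥L] (x : ↥L) (hx : x ≠ 0) :
    ∃ z : ℤ, (Nat.card (↥L ≃ₐ[K] ↥L) : ℝ) * v (x : Ω) = z := by
  obtain ⟨z, hz⟩ := hv.int_valued (Algebra.norm K x) (Algebra.norm_ne_zero_iff.2 hx)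
  refine ⟨z, hz ▸ ?_⟩
  have h : algebraMap K Ω (Algebra.norm K x) = ∏ σ : ↥L ≃ₐ[K] ↥L, (σ x : Ω) := by
    rw [IsScalarTower.algebraMap_apply K ↥L Ω, Algebra.norm_eq_prod_automorphisms, _root_.map_prod]
    rfl
  rw [h, hv.map_prod _ _ fun σ _ => by simpa using hx,
    Finset.sum_congr rfl fun σ _ => hv.map_galois σ x, Finset.sum_const, Finset.card_univ,
    nsmul_eq_mul, Nat.card_eq_fintype_card]

theorem IsCDV.isIntegral_iff (hv : IsCDV K Ω v) (L : IntermediateField K Ω)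
    [FiniteDimensional K ↥L] [IsGalois K ↥L] (x : ↥L) :
    IsIntegral (hv.intRing (algebraMap K Ω)) x ↔ ValGe v 0 (x : Ω) := by
  constructor
  · rintro ⟨p, hp, hx⟩
    let f : hv.intRing (algebraMap K Ω) →+* hv.intRing (algebraMap ↥L Ω) :=
      ((algebraMap K ↥L).comp (hv.intRing (algebraMap K Ω)).subtype).codRestrict
        (hv.intRing (algebraMap ↥L Ω)) fun y => y.2
    have hint : IsIntegral (hv.intRing (algebraMap ↥L Ω)) x := by
      refine ⟨p.map f, hp.map f, ?_⟩
      rw [eval₂_map]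
      exact hx
    obtain ⟨y, rfl⟩ := IsIntegrallyClosed.isIntegral_iff.1 hint
    exact y.2
  · intro hx
    have hlift : relCharpoly ⊥ L x ∈
        lifts ((algebraMap K Ω).comp (hv.intRing (algebraMap K Ω)).subtype) := by
      rw [lifts_iff_coeff_lifts]
      intro i
      obtain ⟨y, hy⟩ := IntermediateField.mem_bot.1 (coeff_relCharpoly_mem bot_le x i)
      have hyv : ValGe v 0 (algebraMap K Ω y) := hy ▸ hv.valGe_coeff_relCharpoly hx i
      exact ⟨⟨y, hyv⟩, hy⟩
    obtain ⟨q, hq, -, hmonic⟩ := lifts_and_natDegree_eq_and_monic hlift (monic_relCharpoly x)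
    refine ⟨q, hmonic, Subtype.val_injective ?_⟩
    have h := eval_self_relCharpoly (F := ⊥) x
    rw [← hq, eval_map] at h
    rw [ZeroMemClass.coe_zero, ← h]
    exact hom_eval₂ q (algebraMap (hv.intRing (algebraMap K Ω)) ↥L) L.val.toRingHom x

theorem IsCDV.exists_isGenerator (hv : IsCDV K Ω v) (hperf : PerfectResidue v K)
    (L : IntermediateField K Ω) [FiniteDimensional K ↥L] [IsGalois K ↥L] :
    ∃ α : ↥L, IsGenerator v L α := by
  let A := hv.intRing (algebraMap K Ω)
  let B := hv.intRing (algebraMap ↥L Ω)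
  let f : A →+* B := ((algebraMap K ↥L).comp A.subtype).codRestrict B fun y => y.2
  let : Algebra A B := f.toAlgebra
  have htower : IsScalarTower A B ↥L := IsScalarTower.of_algebraMap_eq fun _ => rfl
  have hclosure : IsIntegralClosure B A ↥L :=
    { algebraMap_injective := Subtype.val_injective
      isIntegral_iff := fun {x} => by
        rw [hv.isIntegral_iff L x]
        exact ⟨fun h => ⟨⟨x, h⟩, rfl⟩, fun ⟨y, hy⟩ => hy ▸ y.2⟩ }
  have hpA : IsPrincipalIdealRing A :=
    hv.isPrincipalIdealRing_intRing _ 1 one_pos fun x hx => by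
      simpa using hv.int_valued x hx
  have hpB : IsPrincipalIdealRing B :=
    hv.isPrincipalIdealRing_intRing _ (Nat.card (↥L ≃ₐ[K] ↥L)) (by exact_mod_cast Nat.card_pos)
      (hv.exists_int_mul L)
  have hfin : Module.Finite A B := IsIntegralClosure.finite A K ↥L B
  have hfaith : FaithfulSMul A B := by
    rw [faithfulSMul_iff_algebraMap_injective]
    intro x y hxy
    exact Subtype.ext ((algebraMap K ↥L).injective (congrArg Subtype.val hxy))
  have hperfect : PerfectField (IsLocalRing.ResidueField A) := hv.perfectField_residueField hperf
  obtain ⟨α, hα⟩ := exists_adjoin_singleton_eq_top (A := A) (B := B)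
    (IsPrincipalIdealRing.principal _)
  refine ⟨α, α.2, fun x hx => ?_⟩
  have hxα : (⟨x, hx⟩ : B) ∈ Algebra.adjoin A {α} := hα ▸ trivial
  rw [Algebra.adjoin_singleton_eq_range_aeval] at hxα
  obtain ⟨p, hp⟩ := hxα
  refine ⟨p.map A.subtype, fun i => ?_, ?_⟩
  · rw [coeff_map]
    exact (p.coeff i).2
  · have h := congrArg (algebraMap B ↥L) hp
    change _ = x at h
    rw [← h]
    change _ = algebraMap B ↥L (aeval α p)
    rw [← aeval_algebraMap_apply, aeval_def, eval₂_map]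
    rfl

end Fontaine

namespace Fontaine

open Polynomial

variable {K Ω : Type} [Field K] [Field Ω] [Algebra K Ω] {v : Ω → ℝ}

section IntegralPolynomials

variable {p : Polynomial Ω}

theorem IsCDV.exists_map_eq (hv : IsCDV K Ω v) {F : Type} [Field F] (φ : F →+* Ω)
    (hp : ∀ i, ValGe v 0 (p.coeff i)) (hF : ∀ i, p.coeff i ∈ φ.range) :
    ∃ q : Polynomial (hv.intRing φ), q.map (φ.comp (hv.intRing φ).subtype) = p := by
  refine (mem_lifts _).1 ((lifts_iff_coeff_lifts _).2 fun i => ?_)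
  obtain ⟨y, hy⟩ := hF i
  exact ⟨⟨y, hv.mem_intRing φ |>.2 (hy ▸ hp i)⟩, hy⟩

theorem IsCDV.exists_subtype_map_eq (hv : IsCDV K Ω v) (hp : ∀ i, ValGe v 0 (p.coeff i)) :
    ∃ q : Polynomial (hv.intRing (RingHom.id Ω)),
      q.map (hv.intRing (RingHom.id Ω)).subtype = p :=
  hv.exists_map_eq (RingHom.id Ω) hp fun i => ⟨p.coeff i, rfl⟩

theorem IsCDV.valGe_eval (hv : IsCDV K Ω v) (hp : ∀ i, ValGe v 0 (p.coeff i)) {a : Ω}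
    (ha : ValGe v 0 a) : ValGe v 0 (p.eval a) := by
  obtain ⟨q, rfl⟩ := hv.exists_subtype_map_eq hp
  have h := eval_map_apply (hv.intRing (RingHom.id Ω)).subtype (p := q)
    (⟨a, ha⟩ : hv.intRing (RingHom.id Ω))
  exact h ▸ (q.eval _).2

theorem IsCDV.valGe_eval_sub_eval (hv : IsCDV K Ω v) (hp : ∀ i, ValGe v 0 (p.coeff i))
    {a b : Ω} (ha : ValGe v 0 a) (hb : ValGe v 0 b) {m : ℝ} (hab : ValGe v m (a - b)) :
    ValGe v m (p.eval a - p.eval b) := by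
  obtain ⟨q, rfl⟩ := hv.exists_subtype_map_eq hp
  have h := eval_map_apply (hv.intRing (RingHom.id Ω)).subtype (p := q)
  have h₁ := h (⟨a, ha⟩ : hv.intRing (RingHom.id Ω))
  have h₂ := h (⟨b, hb⟩ : hv.intRing (RingHom.id Ω))
  obtain ⟨c, hc⟩ := sub_dvd_eval_sub (⟨a, ha⟩ : hv.intRing (RingHom.id Ω)) ⟨b, hb⟩ q
  have hc' := congrArg (hv.intRing (RingHom.id Ω)).subtype hc
  rw [map_sub, _root_.map_mul, ← h₁, ← h₂] at hc'
  change eval a _ - eval b _ = (a - b) * c at hc'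
  rw [hc', mul_comm]
  exact hv.valGe_mul_left c.2 hab

theorem IsCDV.exists_eq_prod_mul (hv : IsCDV K Ω v) (hp : ∀ i, ValGe v 0 (p.coeff i))
    {ι : Type*} [Fintype ι] (a : ι → Ω) (ha : ∀ i, ValGe v 0 (a i))
    (hinj : Function.Injective a) (hroot : ∀ i, p.eval (a i) = 0) :
    ∃ q : Polynomial Ω, (∀ i, ValGe v 0 (q.coeff i)) ∧ p = (∏ i, (X - C (a i))) * q := by
  rcases eq_or_ne p 0 with rfl | hp0
  · exact ⟨0, fun i => Or.inl (coeff_zero i), (mul_zero _).symm⟩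
  obtain ⟨q, rfl⟩ := hv.exists_subtype_map_eq hp
  have hq0 : q ≠ 0 := by
    rintro rfl
    exact hp0 (Polynomial.map_zero _)
  let a' : ι → hv.intRing (RingHom.id Ω) := fun i => ⟨a i, ha i⟩
  have ha' : Function.Injective a' := fun i j h => hinj (congrArg Subtype.val h)
  have hle : Finset.univ.val.map a' ≤ q.roots := by
    refine (Multiset.le_iff_subset (Finset.univ.nodup.map ha')).2 fun y hy => ?_
    obtain ⟨i, -, rfl⟩ := Multiset.mem_map.1 hy
    refine (mem_roots hq0).2 (Subtype.val_injective ?_)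
    have h := eval_map_apply (hv.intRing (RingHom.id Ω)).subtype (p := q) (a' i)
    exact h.symm.trans (hroot i)
  obtain ⟨r, hr⟩ := (Multiset.prod_X_sub_C_dvd_iff_le_roots hq0 _).2 hle
  refine ⟨r.map (hv.intRing (RingHom.id Ω)).subtype, fun i => ?_, ?_⟩
  · rw [coeff_map]
    exact (r.coeff i).2
  · rw [hr, Polynomial.map_mul, Multiset.map_map]
    congr 1
    change (∏ i, (X - C (a' i))).map _ = _
    rw [Polynomial.map_prod]
    refine Finset.prod_congr rfl fun i _ => ?_
    rw [Polynomial.map_sub, map_X, map_C]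
    rfl

end IntegralPolynomials

section Generators

variable {L : IntermediateField K Ω} {α : ↥L}

theorem coe_aeval_eq_eval (p : K[X]) (x : ↥L) :
    ((aeval x p : ↥L) : Ω) = (p.map (algebraMap K Ω)).eval (x : Ω) := by
  rw [eval_map_algebraMap]
  exact (aeval_algHom_apply L.val x p).symm

theorem IsGenerator.galois (hv : IsCDV K Ω v) (hα : IsGenerator v L α) (σ : ↥L ≃ₐ[K] ↥L) :
    IsGenerator v L (σ α) := by
  refine ⟨hv.valGe_galois σ hα.1, fun x hx => ?_⟩
  obtain ⟨p, hp, hpx⟩ := hα.2 (σ.symm x) (hv.valGe_galois σ.symm hx)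
  refine ⟨p, hp, ?_⟩
  rw [aeval_algHom_apply, hpx, AlgEquiv.apply_symm_apply]

theorem IsGenerator.valGe_sub (hv : IsCDV K Ω v) (hα : IsGenerator v L α)
    {σ : ↥L ≃ₐ[K] ↥L} {m : ℝ} (hσ : ValGe v m ((σ α : Ω) - α)) {x : ↥L}
    (hx : ValGe v 0 (x : Ω)) : ValGe v m ((σ x : Ω) - x) := by
  obtain ⟨p, hp, rfl⟩ := hα.2 x hx
  rw [← aeval_algHom_apply, coe_aeval_eq_eval, coe_aeval_eq_eval]
  exact hv.valGe_eval_sub_eval (fun i => (coeff_map (algebraMap K Ω) i).symm ▸ hp i)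
    (hv.valGe_galois σ hα.1) hα.1 hσ

theorem IsGenerator.eq_one (hv : IsCDV K Ω v) (hα : IsGenerator v L α)
    {σ : ↥L ≃ₐ[K] ↥L} (hσ : σ α = α) : σ = 1 := by
  have hint : ∀ x : ↥L, ValGe v 0 (x : Ω) → σ x = x := by
    intro x hx
    obtain ⟨p, -, rfl⟩ := hα.2 x hx
    rw [← aeval_algHom_apply, hσ]
  ext x
  rw [AlgEquiv.one_apply]
  rcases (hv.intRing (algebraMap ↥L Ω)).mem_or_inv_mem x with h | h
  · rw [hint x h]
  · have := hint x⁻¹ h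
    rw [map_inv₀, inv_inj] at this
    rw [this]

theorem IsGenerator.coe_sub_ne_zero (hv : IsCDV K Ω v) (hα : IsGenerator v L α)
    {σ : ↥L ≃ₐ[K] ↥L} (hσ : σ ≠ 1) : (σ α : Ω) - α ≠ 0 := fun h =>
  hσ (hα.eq_one hv (Subtype.ext (sub_eq_zero.1 h)))

end Generators

section Normalization

variable {F L : IntermediateField K Ω}

theorem IsCDV.ramIdx_pos (hv : IsCDV K Ω v) [FiniteDimensional K ↥L] [IsGalois K ↥L]
    (hFL : F ≤ L) : 0 < ramIdx v F := by
  set n : ℝ := (Nat.card (↥L ≃ₐ[K] ↥L) : ℝ) with hn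
  have hn0 : 0 < n := by
    rw [hn]
    exact_mod_cast Nat.card_pos
  let c : ℝ := if 0 < v 0 then min n⁻¹ (v 0) else n⁻¹
  have hc : 0 < c := by
    by_cases h : 0 < v 0
    · simp only [c, if_pos h]
      exact lt_min (inv_pos.2 hn0) h
    · simp only [c, if_neg h]
      exact inv_pos.2 hn0
  refine inv_pos.2 (hc.trans_le (le_csInf ?_ ?_))
  · obtain ⟨x, hx⟩ := hv.exists_uniformizer
    exact ⟨1, one_pos, algebraMap K Ω x, F.algebraMap_mem x, hx⟩
  · rintro r ⟨hr, x, hx, rfl⟩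
    rcases eq_or_ne x 0 with rfl | hx0
    · simp only [c, if_pos hr]
      exact min_le_right _ _
    · have hle : n⁻¹ ≤ v x := by
        obtain ⟨z, hz⟩ := hv.exists_int_mul L ⟨x, hFL hx⟩ fun h => hx0 (congrArg Subtype.val h)
        change n * v x = z at hz
        have hz0 : (0 : ℝ) < z := hz ▸ mul_pos hn0 hr
        have hz1 : (1 : ℝ) ≤ z := by exact_mod_cast (by exact_mod_cast hz0 : 0 < z)
        rw [inv_le_iff_one_le_mul₀ hn0, mul_comm]
        exact hz1.trans hz.ge
      refine le_trans ?_ hle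
      by_cases h : 0 < v 0
      · simp only [c, if_pos h]
        exact min_le_left _ _
      · simp only [c, if_neg h, le_refl]

theorem inId_iff (hs : 0 < ramIdx v F) {m : ℝ} {x : Ω} :
    InId v F m x ↔ ValGe v (m / ramIdx v F) x :=
  or_congr Iff.rfl (div_le_iff₀ hs).symm

variable {α : ↥L}

theorem IsGenerator.lowerAt_iff (hv : IsCDV K Ω v) (hα : IsGenerator v L α)
    (hs : 0 < ramIdx v F) {σ : ↥L ≃ₐ[K] ↥L} {i : ℝ} :
    lowerAt v F L σ i ↔ σ ∈ relGal F L ∧ ValGe v (i / ramIdx v F) ((σ α : Ω) - α) := by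
  have hiff : ∀ x : ↥L, (σ x = x ∨ i ≤ vRel v F ((σ x : Ω) - x)) ↔
      ValGe v (i / ramIdx v F) ((σ x : Ω) - x) := by
    intro x
    rw [← inId_iff hs, InId, sub_eq_zero, Subtype.coe_inj]
  refine and_congr Iff.rfl ⟨fun h => (hiff α).1 (h α ⟨α.2, hα.1⟩), fun h x hx => ?_⟩
  exact (hiff x).2 (hα.valGe_sub hv h hx.2)

theorem IsGenerator.lowerAt_iff_le (hv : IsCDV K Ω v) (hα : IsGenerator v L α)
    (hs : 0 < ramIdx v F) {σ : ↥L ≃ₐ[K] ↥L} (hσF : σ ∈ relGal F L) (hσ : σ ≠ 1) {i : ℝ} :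
    lowerAt v F L σ i ↔ i ≤ vRel v F ((σ α : Ω) - α) := by
  rw [hα.lowerAt_iff hv hs, ← inId_iff hs, InId, or_iff_right (hα.coe_sub_ne_zero hv hσ)]
  exact and_iff_right hσF

theorem IsGenerator.iFon_eq (hv : IsCDV K Ω v) (hα : IsGenerator v L α)
    (hs : 0 < ramIdx v F) {σ : ↥L ≃ₐ[K] ↥L} (hσF : σ ∈ relGal F L) (hσ : σ ≠ 1) :
    iFon v F L σ = vRel v F ((σ α : Ω) - α) := by
  have : {i : ℝ | lowerAt v F L σ i} = Set.Iic (vRel v F ((σ α : Ω) - α)) :=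
    Set.ext fun i => hα.lowerAt_iff_le hv hs hσF hσ
  rw [iFon, this, csSup_Iic]

theorem iBreak_eq_zero (h : ∀ σ ∈ relGal F L, σ = 1) : iBreak v F L = 0 := by
  have : {i : ℝ | ∃ σ : ↥L ≃ₐ[K] ↥L, σ ≠ 1 ∧ lowerAt v F L σ i} = ∅ := by
    refine Set.eq_empty_of_forall_notMem ?_
    rintro i ⟨σ, hσ, hi⟩
    exact hσ (h σ hi.1)
  rw [iBreak, this, Real.sSup_empty]

variable [FiniteDimensional K ↥L]

theorem IsGenerator.exists_isGreatest (hv : IsCDV K Ω v) (hα : IsGenerator v L α)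
    (hs : 0 < ramIdx v F) (h : ∃ σ ∈ relGal F L, σ ≠ 1) :
    ∃ σ ∈ relGal F L, σ ≠ 1 ∧ IsGreatest
      {i : ℝ | ∃ σ : ↥L ≃ₐ[K] ↥L, σ ≠ 1 ∧ lowerAt v F L σ i} (vRel v F ((σ α : Ω) - α)) := by
  obtain ⟨σ, ⟨hσF, hσ⟩, hmax⟩ :=
    (Set.toFinite {σ : ↥L ≃ₐ[K] ↥L | σ ∈ relGal F L ∧ σ ≠ 1}).exists_maximalFor
      (fun σ => vRel v F ((σ α : Ω) - α)) _ h
  refine ⟨σ, hσF, hσ, ⟨σ, hσ, (hα.lowerAt_iff_le hv hs hσF hσ).2 le_rfl⟩, ?_⟩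
  rintro i ⟨τ, hτ, hi⟩
  refine ((hα.lowerAt_iff_le hv hs hi.1 hτ).1 hi).trans ?_
  rcases le_total (vRel v F ((σ α : Ω) - α)) (vRel v F ((τ α : Ω) - α)) with h | h
  · exact hmax ⟨hi.1, hτ⟩ h
  · exact h

theorem IsGenerator.exists_iBreak_eq (hv : IsCDV K Ω v) (hα : IsGenerator v L α)
    (hs : 0 < ramIdx v F) (h : ∃ σ ∈ relGal F L, σ ≠ 1) :
    ∃ σ ∈ relGal F L, σ ≠ 1 ∧ iBreak v F L = vRel v F ((σ α : Ω) - α) := by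
  obtain ⟨σ, hσF, hσ, hmax⟩ := hα.exists_isGreatest hv hs h
  exact ⟨σ, hσF, hσ, hmax.csSup_eq⟩

theorem IsGenerator.le_iBreak (hv : IsCDV K Ω v) (hα : IsGenerator v L α)
    (hs : 0 < ramIdx v F) {σ : ↥L ≃ₐ[K] ↥L} (hσF : σ ∈ relGal F L) (hσ : σ ≠ 1) :
    vRel v F ((σ α : Ω) - α) ≤ iBreak v F L := by
  obtain ⟨τ, -, -, hmax⟩ := hα.exists_isGreatest hv hs ⟨σ, hσF, hσ⟩
  rw [iBreak, hmax.csSup_eq]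
  exact hmax.2 ⟨σ, hσ, (hα.lowerAt_iff_le hv hs hσF hσ).2 le_rfl⟩

/-- The valuation of `β - σ α` for `σ ∈ Gal(L/F)`, when `β` is at the distance of the largest
lower ramification break from `α`. -/
def breakDist (v : Ω → ℝ) (F L : IntermediateField K Ω) (α : ↥L) (σ : ↥L ≃ₐ[K] ↥L) : ℝ :=
  if σ = 1 then iBreak v F L / ramIdx v F else v ((σ α : Ω) - α)

theorem IsGenerator.breakDist_le (hv : IsCDV K Ω v) (hα : IsGenerator v L α)
    (hs : 0 < ramIdx v F) {σ : ↥L ≃ₐ[K] ↥L} (hσF : σ ∈ relGal F L) :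
    breakDist v F L α σ ≤ iBreak v F L / ramIdx v F := by
  unfold breakDist
  split_ifs with hσ
  · exact le_rfl
  · rw [le_div_iff₀ hs]
    exact hα.le_iBreak hv hs hσF hσ

theorem IsGenerator.uBreak_div (hv : IsCDV K Ω v) (hα : IsGenerator v L α)
    (hs : 0 < ramIdx v F) :
    uBreak v F L / ramIdx v F = ∑ σ : relSubgroup F L, breakDist v F L α σ.1 := by
  have h₁ : ∑ᶠ σ ∈ {σ : ↥L ≃ₐ[K] ↥L | σ ∈ relGal F L ∧ σ ≠ 1},
      min (iFon v F L σ) (iBreak v F L) =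
      ∑ σ ∈ (Finset.univ : Finset (relSubgroup F L)).erase 1,
        ramIdx v F * breakDist v F L α σ.1 := by
    rw [finsum_mem_eq_toFinset_sum]
    symm
    refine Finset.sum_bij (fun σ _ => σ.1) ?_ (fun _ _ _ _ => Subtype.ext) ?_ ?_
    · intro σ hσ
      rw [Set.mem_toFinset]
      exact ⟨σ.2, fun h => Finset.ne_of_mem_erase hσ (Subtype.ext h)⟩
    · intro σ hσ
      obtain ⟨hσF, hσ⟩ := Set.mem_toFinset.1 hσ
      exact ⟨⟨σ, hσF⟩, Finset.mem_erase.2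
        ⟨fun h => hσ (congrArg Subtype.val h), Finset.mem_univ _⟩, rfl⟩
    · intro σ hσ
      have hσ1 : σ.1 ≠ 1 := fun h => Finset.ne_of_mem_erase hσ (Subtype.ext h)
      rw [hα.iFon_eq hv hs σ.2 hσ1, min_eq_left (hα.le_iBreak hv hs σ.2 hσ1), breakDist,
        if_neg hσ1, vRel, mul_comm]
  rw [uBreak, phiT, h₁, ← Finset.mul_sum, add_div, mul_div_cancel_left₀ _ hs.ne',
    ← Finset.add_sum_erase _ _ (Finset.mem_univ 1)]
  congr 1
  exact (if_pos rfl).symm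

theorem IsGenerator.valGe_eval_relCharpoly (hv : IsCDV K Ω v) (hα : IsGenerator v L α)
    (hs : 0 < ramIdx v F) {β : Ω} (hβ : ValGe v (iBreak v F L / ramIdx v F) (β - α)) :
    ValGe v (uBreak v F L / ramIdx v F) ((relCharpoly F L α).eval β) := by
  rw [eval_relCharpoly, hα.uBreak_div hv hs]
  refine hv.valGe_prod _ _ _ fun σ _ => ?_
  have h : β - ((σ.1 α : ↥L) : Ω) = (β - α) - ((σ.1 α : Ω) - α) := by ring
  rw [h]
  refine hv.valGe_sub (hβ.mono (hα.breakDist_le hv hs σ.2)) ?_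
  by_cases hσ : σ.1 = 1
  · left
    rw [hσ, AlgEquiv.one_apply, sub_self]
  · right
    rw [breakDist, if_neg hσ]

theorem IsGenerator.exists_valGe_sub (hv : IsCDV K Ω v) (hα : IsGenerator v L α)
    (hs : 0 < ramIdx v F) {β : Ω}
    (hβ : ValGe v (uBreak v F L / ramIdx v F) ((relCharpoly F L α).eval β)) :
    ∃ σ ∈ relGal F L, ValGe v (iBreak v F L / ramIdx v F) (β - (σ α : Ω)) := by
  by_contra! hcon
  have hcon' : ∀ σ ∈ relGal F L, β - (σ α : Ω) ≠ 0 ∧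
      v (β - (σ α : Ω)) < iBreak v F L / ramIdx v F := fun σ hσ => by
    simpa [ValGe, not_or] using hcon σ hσ
  obtain ⟨σ₀, -, hmax⟩ := Finset.exists_max_image (Finset.univ : Finset (relSubgroup F L))
    (fun σ => v (β - (σ.1 α : Ω))) ⟨1, Finset.mem_univ 1⟩
  rw [eval_relCharpoly, hα.uBreak_div hv hs] at hβ
  have hne : ∏ σ : relSubgroup F L, (β - ((σ.1 α : ↥L) : Ω)) ≠ 0 :=
    Finset.prod_ne_zero_iff.2 fun σ _ => (hcon' σ.1 σ.2).1
  refine (hβ.le hne).not_gt ?_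
  rw [hv.map_prod _ _ fun σ _ => (hcon' σ.1 σ.2).1, ← Equiv.sum_comp (Equiv.mulLeft σ₀)]
  refine Finset.sum_lt_sum (fun σ _ => ?_) ⟨1, Finset.mem_univ 1, ?_⟩
  · by_cases hσ : σ.1 = 1
    · rw [breakDist, if_pos hσ]
      exact (hcon' _ (σ₀ * σ).2).2.le
    · have hd : v ((σ.1 α : Ω) - α) = v ((σ₀.1 (σ.1 α) : Ω) - σ₀.1 α) := by
        have := hv.map_galois σ₀.1 (σ.1 α - α)
        rw [map_sub] at this
        exact this.symm
      rw [breakDist, if_neg hσ, hd]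
      have hne' : (σ₀.1 (σ.1 α) : Ω) - σ₀.1 α ≠ 0 := by
        have := (map_ne_zero σ₀.1).2 fun h => hσ (hα.eq_one hv (sub_eq_zero.1 h))
        rw [map_sub] at this
        exact fun h => this (Subtype.ext h)
      have h : ValGe v (v (β - (σ₀.1 (σ.1 α) : Ω)))
          ((β - (σ₀.1 α : Ω)) - (β - (σ₀.1 (σ.1 α) : Ω))) :=
        hv.valGe_sub (Or.inr (hmax (σ₀ * σ) (Finset.mem_univ _))) (Or.inr le_rfl)
      rw [sub_sub_sub_cancel_left] at h
      exact h.le hne'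
  · rw [breakDist, if_pos (OneMemClass.coe_one _)]
    exact (hcon' _ (σ₀ * 1).2).2

end Normalization

end Fontaine

namespace Fontaine

open Polynomial

variable {K Ω : Type} [Field K] [Field Ω] [Algebra K Ω] {v : Ω → ℝ}
  {F L E : IntermediateField K Ω} [FiniteDimensional K ↥L]

theorem IsGenerator.homMod (hv : IsCDV K Ω v) {α : ↥L} (hα : IsGenerator v L α)
    (hs : 0 < ramIdx v F) (hFL : F ≤ L) {β : Ω} (hβE : β ∈ E) (hβ : ValGe v 0 β)
    (hβα : ValGe v (iBreak v F L / ramIdx v F) (β - α)) :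
    HomMod v F L E (uBreak v F L) := by
  have key : ∀ (r : K[X]) (c : Ω) (hc : c ∈ F), ValGe v 0 c →
      (∀ i, ValGe v 0 (algebraMap K Ω (r.coeff i))) → aeval α r = ⟨c, hFL hc⟩ →
      InId v F (uBreak v F L) (aeval β r - c) := by
    intro r c hc hcv hr hrc
    have hcoeff : ∀ i, ValGe v 0 ((r.map (algebraMap K Ω) - C c).coeff i) := by
      intro i
      rw [coeff_sub, coeff_map, coeff_C]
      refine hv.valGe_sub (hr i) ?_
      split_ifs
      · exact hcv
      · exact Or.inl rfl
    obtain ⟨q, hq, hqr⟩ := hv.exists_eq_prod_mul hcoeff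
      (fun σ : relSubgroup F L => ((σ.1 α : ↥L) : Ω)) (fun σ => hv.valGe_galois σ.1 hα.1)
      (fun σ τ h => by
        have h' : σ.1 α = τ.1 α := Subtype.ext h
        have : τ.1⁻¹ * σ.1 = 1 := hα.eq_one hv (by
          rw [AlgEquiv.mul_apply, h']
          exact τ.1.symm_apply_apply α)
        exact Subtype.ext (inv_mul_eq_one.1 this).symm)
      (fun σ => by
        rw [eval_sub, eval_C, ← coe_aeval_eq_eval, aeval_algHom_apply, hrc, σ.2 _ hc, sub_self])
    change _ = relCharpoly F L α * q at hqr
    have heval : aeval β r - c = q.eval β * (relCharpoly F L α).eval β := by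
      rw [mul_comm, ← eval_mul, ← hqr, eval_sub, eval_C, eval_map_algebraMap]
    rw [inId_iff hs, heval]
    exact hv.valGe_mul_left (hv.valGe_eval hq hβ) (hα.valGe_eval_relCharpoly hv hs hβα)
  have hex : ∀ x : Ω, ∃ p : K[X], (∀ i, ValGe v 0 (algebraMap K Ω (p.coeff i))) ∧
      ∀ hx : IsInt v L x, aeval α p = ⟨x, hx.1⟩ := by
    intro x
    by_cases hx : IsInt v L x
    · obtain ⟨p, hp, hpx⟩ := hα.2 ⟨x, hx.1⟩ hx.2
      exact ⟨p, hp, fun _ => hpx⟩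
    · exact ⟨0, fun i => Or.inl (by rw [coeff_zero, map_zero]), fun h => absurd h hx⟩
  choose p hp hpx using hex
  have hpC : ∀ x i, ValGe v 0 (((p x).map (algebraMap K Ω)).coeff i) := fun x i =>
    (coeff_map (algebraMap K Ω) i).symm ▸ hp x i
  have hzero : ∀ r : K[X], (∀ i, ValGe v 0 (algebraMap K Ω (r.coeff i))) → aeval α r = 0 →
      InId v F (uBreak v F L) (aeval β r) := by
    intro r hr h0
    have := key r 0 F.zero_mem (Or.inl rfl) hr h0
    rwa [sub_zero] at this
  let A := hv.intRing (algebraMap K Ω)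
  have hlift : ∀ r : K[X], (∀ i, ValGe v 0 (algebraMap K Ω (r.coeff i))) ↔
      r ∈ liftsRing A.subtype := by
    intro r
    refine Iff.trans ?_ (lifts_iff_coeff_lifts r).symm
    exact forall_congr' fun i => ⟨fun h => ⟨⟨_, h⟩, rfl⟩, fun ⟨y, hy⟩ => hy ▸ y.2⟩
  have hpl : ∀ x, p x ∈ liftsRing A.subtype := fun x => (hlift _).1 (hp x)
  refine ⟨fun x => aeval β (p x), fun x _ => ⟨?_, ?_⟩, fun x y hx hy => ?_, fun x y hx hy => ?_,
    ?_, fun c hc => ?_⟩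
  · have h := aeval_algHom_apply E.val (⟨β, hβE⟩ : ↥E) (p x)
    change aeval β (p x) = _ at h
    change aeval β (p x) ∈ E
    rw [h]
    exact (aeval (⟨β, hβE⟩ : ↥E) (p x)).2
  · have h := hv.valGe_eval (hpC x) hβ
    rwa [eval_map_algebraMap] at h
  · have hxy : IsInt v L (x + y) := ⟨add_mem hx.1 hy.1, hv.valGe_add hx.2 hy.2⟩
    rw [← map_add, ← map_sub]
    refine hzero _ ((hlift _).2 (Subring.sub_mem _ (hpl _) (Subring.add_mem _ (hpl _) (hpl _)))) ?_
    rw [map_sub, map_add, hpx _ hxy, hpx _ hx, hpx _ hy]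
    exact sub_self _
  · have hxy : IsInt v L (x * y) := ⟨mul_mem hx.1 hy.1, hv.valGe_mul_left hx.2 hy.2⟩
    rw [← map_mul, ← map_sub]
    refine hzero _ ((hlift _).2 (Subring.sub_mem _ (hpl _) (Subring.mul_mem _ (hpl _) (hpl _)))) ?_
    rw [map_sub, map_mul, hpx _ hxy, hpx _ hx, hpx _ hy]
    exact sub_self _
  · exact key _ 1 F.one_mem hv.valGe_one (hp 1) (hpx 1 ⟨L.one_mem, hv.valGe_one⟩)
  · exact key _ c hc.1 hc.2 (hp c) (hpx c ⟨hFL hc.1, hc.2⟩)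

omit [FiniteDimensional K ↥L] in
theorem IsHomMod.inId_eval_sub (hv : IsCDV K Ω v) (hs : 0 < ramIdx v F) (hFL : F ≤ L)
    {m : ℝ} {f : Ω → Ω} (hf : IsHomMod v F L E m f) {α : ↥L}
    (hα : ValGe v 0 (α : Ω)) {p : Polynomial Ω} (hp : ∀ i, ValGe v 0 (p.coeff i))
    (hpF : ∀ i, p.coeff i ∈ F) :
    InId v F m (f (p.eval (α : Ω)) - p.eval (f α)) := by
  obtain ⟨hfint, hfadd, hfmul, -, hfF⟩ := hf
  have hαint : IsInt v L (α : Ω) := ⟨α.2, hα⟩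
  obtain ⟨q, rfl⟩ := hv.exists_map_eq (algebraMap ↥F Ω) hp fun i => ⟨⟨_, hpF i⟩, rfl⟩
  simp only [inId_iff hs] at *
  set φ : hv.intRing (algebraMap ↥F Ω) →+* Ω :=
    (algebraMap ↥F Ω).comp (hv.intRing (algebraMap ↥F Ω)).subtype
  have hφ : ∀ a, IsInt v F (φ a) := fun a => ⟨(a : ↥F).2, a.2⟩
  have hint : ∀ q : Polynomial (hv.intRing (algebraMap ↥F Ω)), IsInt v L (q.eval₂ φ (α : Ω)) := by
    intro q
    induction q using Polynomial.induction_on' with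
    | add p q hp hq =>
      rw [eval₂_add]
      exact ⟨add_mem hp.1 hq.1, hv.valGe_add hp.2 hq.2⟩
    | monomial n a =>
      rw [eval₂_monomial]
      refine ⟨mul_mem (hFL (hφ a).1) (pow_mem α.2 n), hv.valGe_mul_left (hφ a).2 ?_⟩
      exact (hv.intRing (RingHom.id Ω)).toSubring.pow_mem
        (show (α : Ω) ∈ (hv.intRing (RingHom.id Ω)).toSubring from hα) n
  rw [eval_map, eval_map]
  clear hp hpF
  induction q using Polynomial.induction_on with
  | C a =>
    rw [eval₂_C, eval₂_C]
    exact hfF _ (hφ a)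
  | add p q hp hq =>
    rw [eval₂_add, eval₂_add]
    have h := hv.valGe_add (hfadd _ _ (hint p) (hint q)) (hv.valGe_add hp hq)
    convert h using 1
    ring
  | monomial n a ih =>
    have hmul : ∀ z, eval₂ φ z (C a * X ^ (n + 1)) = eval₂ φ z (C a * X ^ n) * z := fun z => by
      rw [pow_succ, ← mul_assoc, eval₂_mul, eval₂_X]
    rw [hmul, hmul]
    have h := hv.valGe_add (hfmul _ _ (hint (C a * X ^ n)) hαint)
      (hv.valGe_mul_left (hfint _ hαint).2 ih)
    convert h using 1
    ring

theorem homMod_iff (hv : IsCDV K Ω v) (hperf : PerfectResidue v K) [IsGalois K ↥L]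
    (hFL : F ≤ L) :
    HomMod v F L E (uBreak v F L) ↔ ∃ α : ↥L, IsGenerator v L α ∧ ∃ β ∈ E, ValGe v 0 β ∧
      ValGe v (iBreak v F L / ramIdx v F) (β - α) := by
  have hs : 0 < ramIdx v F := hv.ramIdx_pos hFL
  constructor
  · rintro ⟨f, hf⟩
    obtain ⟨α, hα⟩ := hv.exists_isGenerator hperf L
    have hβ := hf.1 α ⟨α.2, hα.1⟩
    have h0 : InId v F (uBreak v F L) (f 0) := by
      have := hf.2.2.2.2 0 ⟨F.zero_mem, Or.inl rfl⟩
      rwa [sub_zero] at this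
    have h := hf.inId_eval_sub hv hs hFL hα.1
      (hv.valGe_coeff_relCharpoly (F := F) hα.1) (coeff_relCharpoly_mem hFL α)
    rw [eval_self_relCharpoly] at h
    rw [inId_iff hs] at h h0
    have hP := hv.valGe_sub h0 h
    rw [sub_sub_cancel] at hP
    obtain ⟨σ, -, hσ⟩ := hα.exists_valGe_sub hv hs hP
    exact ⟨σ α, hα.galois hv σ, f α, hβ.1, hβ.2, hσ⟩
  · rintro ⟨α, hα, β, hβE, hβ, hβα⟩
    exact hα.homMod hv hs hFL hβE hβ hβα

omit [FiniteDimensional K ↥L] in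
theorem ramFixed_le : ramFixed v L ≤ L := fun _ hx => hx.1

omit [FiniteDimensional K ↥L] in
theorem mem_relGal_bot (σ : ↥L ≃ₐ[K] ↥L) : σ ∈ relGal ⊥ L := by
  intro x hx
  obtain ⟨y, hy⟩ := IntermediateField.mem_bot.1 hx
  have : x = algebraMap K ↥L y := Subtype.ext hy.symm
  rw [this, AlgEquiv.commutes]

omit [FiniteDimensional K ↥L] in
theorem mem_relGal_ramFixed {σ : ↥L ≃ₐ[K] ↥L} (hσ : lowerAt v ⊥ L σ (iBreak v ⊥ L)) :
    σ ∈ relGal (ramFixed v L) L := fun _ ⟨_, h⟩ => h σ hσ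

/-- The largest lower ramification breaks of `L/M` and `L/K` agree up to normalization. -/
theorem iBreak_ramFixed_div (hv : IsCDV K Ω v) (hperf : PerfectResidue v K) [IsGalois K ↥L] :
    iBreak v (ramFixed v L) L / ramIdx v (ramFixed v L) =
      iBreak v ⊥ L / ramIdx v (⊥ : IntermediateField K Ω) := by
  have hsM : 0 < ramIdx v (ramFixed v L) := hv.ramIdx_pos ramFixed_le
  have hsK : 0 < ramIdx v (⊥ : IntermediateField K Ω) := hv.ramIdx_pos (bot_le : ⊥ ≤ L)
  obtain ⟨α, hα⟩ := hv.exists_isGenerator hperf L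
  by_cases h : ∃ σ : ↥L ≃ₐ[K] ↥L, σ ≠ 1
  · obtain ⟨σ, -, hσ, hσK⟩ := hα.exists_iBreak_eq hv hsK
      (h.imp fun σ hσ => ⟨mem_relGal_bot σ, hσ⟩)
    have hσM : σ ∈ relGal (ramFixed v L) L :=
      mem_relGal_ramFixed ((hα.lowerAt_iff_le hv hsK (mem_relGal_bot σ) hσ).2 hσK.le)
    obtain ⟨τ, hτM, hτ, hτb⟩ := hα.exists_iBreak_eq hv hsM ⟨σ, hσM, hσ⟩
    have h₁ := hα.le_iBreak hv hsM hσM hσ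
    have h₂ := hα.le_iBreak hv hsK (mem_relGal_bot τ) hτ
    rw [hτb] at h₁ ⊢
    rw [hσK] at h₂ ⊢
    simp only [vRel] at *
    rw [mul_div_cancel_right₀ _ hsM.ne', mul_div_cancel_right₀ _ hsK.ne']
    exact le_antisymm (le_of_mul_le_mul_right h₂ hsK) (le_of_mul_le_mul_right h₁ hsM)
  · push Not at h
    rw [iBreak_eq_zero fun σ _ => h σ, iBreak_eq_zero fun σ _ => h σ, zero_div, zero_div]

theorem mem_of_forall_algEquiv [IsAlgClosure K Ω] {x : Ω} (hsep : IsSeparable K x)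
    (h : ∀ τ : Ω ≃ₐ[↥E] Ω, τ x = x) : x ∈ E := by
  have hclosed : IsAlgClosed Ω := IsAlgClosure.isAlgClosed K
  have halg : Algebra.IsAlgebraic K Ω := IsAlgClosure.isAlgebraic
  have halgE : Algebra.IsAlgebraic ↥E Ω := Algebra.IsAlgebraic.tower_top (K := K) ↥E
  have hnormal : Normal ↥E Ω := normal_iff.2 fun y =>
    ⟨Algebra.IsIntegral.isIntegral y, IsAlgClosed.splits _⟩
  by_contra hx
  have hx' : x ∉ (⊥ : Subalgebra ↥E Ω) := by
    rintro ⟨y, rfl⟩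
    exact hx y.2
  obtain ⟨y, hne, hy⟩ := (notMem_iff_exists_ne_and_isConjRoot (K := ↥E)
    (hsep.tower_top ↥E) (IsAlgClosed.splits _)).1 hx'
  obtain ⟨τ, hτ⟩ := isConjRoot_iff_exists_algEquiv.1 hy.symm
  exact hne ((h τ).symm.trans hτ)

theorem IsCDV.map_algEquiv (hv : IsCDV K Ω v) (τ : Ω ≃ₐ[K] Ω) (x : Ω) : v (τ x) = v x :=
  hv.galois_inv ⊤ ((IntermediateField.topEquiv.trans τ).trans IntermediateField.topEquiv.symm)
    ⟨x, trivial⟩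

omit [FiniteDimensional K ↥L] in
theorem exists_algEquiv_coe_eq [IsGalois K ↥L] (τ : Ω ≃ₐ[K] Ω) :
    ∃ σ : ↥L ≃ₐ[K] ↥L, ∀ y : ↥L, (σ y : Ω) = τ y :=
  ⟨τ.restrictNormal ↥L, τ.restrictNormal_commutes ↥L⟩

omit [FiniteDimensional K ↥L] in
theorem isSeparable_coe [IsGalois K ↥L] (x : ↥L) : IsSeparable K (x : Ω) :=
  (Algebra.IsSeparable.isSeparable K x).map L.val L.val.injective

/-- A variant of Krasner's lemma. -/
theorem ramFixed_le_of_valGe_sub (hv : IsCDV K Ω v) [IsAlgClosure K Ω] [IsGalois K ↥L]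
    {α : ↥L} (hα : IsGenerator v L α) {β : Ω} (hβE : β ∈ E)
    (hβ : ValGe v (iBreak v ⊥ L / ramIdx v (⊥ : IntermediateField K Ω)) (β - α)) :
    ramFixed v L ≤ E := by
  have hsK : 0 < ramIdx v (⊥ : IntermediateField K Ω) := hv.ramIdx_pos (bot_le : ⊥ ≤ L)
  suffices h : ∀ x ∈ ramFixed v L, x ∈ E from h
  rintro x ⟨hxL, hxfix⟩
  have hsep : IsSeparable K x := isSeparable_coe (⟨x, hxL⟩ : ↥L)
  refine mem_of_forall_algEquiv hsep fun τ => ?_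
  obtain ⟨σ, hσ⟩ := exists_algEquiv_coe_eq (L := L) (τ.restrictScalars K)
  replace hσ : ∀ y : ↥L, (σ y : Ω) = τ y := hσ
  have hτβ : τ β = β := τ.commutes ⟨β, hβE⟩
  have hτ : ValGe v (iBreak v ⊥ L / ramIdx v (⊥ : IntermediateField K Ω)) (τ (β - α)) :=
    hβ.imp (fun h => by rw [h, map_zero]) fun h => by
      rwa [show v (τ (β - α)) = v (β - α) from hv.map_algEquiv (τ.restrictScalars K) _]
  have hlow : lowerAt v ⊥ L σ (iBreak v ⊥ L) := by
    rw [hα.lowerAt_iff hv hsK]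
    refine ⟨mem_relGal_bot σ, ?_⟩
    have h := hv.valGe_sub hβ hτ
    rwa [map_sub, hτβ, sub_sub_sub_cancel_left, ← hσ] at h
  rw [show τ x = (σ ⟨x, hxL⟩ : Ω) from (hσ ⟨x, hxL⟩).symm, hxfix σ hlow]

end Fontaine

/-- Lemma in Section 2. With `M` the fixed field of
`Gal(L/K)^{(u_{L/K})}`, for an algebraic extension `E` of `K` the following are
equivalent: (1) there is an `O_K`-algebra homomorphism `O_L → O_E/a_{E/K}^{u_{L/K}}`;
(2) `M ⊆ E` and there is an `O_M`-algebra homomorphism `O_L → O_E/a_{E/M}^{u_{L/M}}`. -/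
theorem statement2
    (K Ω : Type) [Field K] [Field Ω] [Algebra K Ω] [IsAlgClosure K Ω]
    (v : Ω → ℝ) (hv : IsCDV K Ω v) (hperf : PerfectResidue v K)
    (L : IntermediateField K Ω) [FiniteDimensional K ↥L] [IsGalois K ↥L]
    (E : IntermediateField K Ω) :
    HomMod v ⊥ L E (uBreak v ⊥ L) ↔
      (ramFixed v L ≤ E ∧ HomMod v (ramFixed v L) L E (uBreak v (ramFixed v L) L)) := by
  rw [homMod_iff hv hperf bot_le]
  constructor
  · rintro ⟨α, hα, β, hβE, hβ, hβα⟩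
    have hME := ramFixed_le_of_valGe_sub hv hα hβE hβα
    refine ⟨hME, (homMod_iff hv hperf ramFixed_le).2 ⟨α, hα, β, hβE, hβ, ?_⟩⟩
    rwa [iBreak_ramFixed_div hv hperf]
  · rintro ⟨hME, h⟩
    obtain ⟨α, hα, β, hβE, hβ, hβα⟩ := (homMod_iff hv hperf ramFixed_le).1 h
    rw [iBreak_ramFixed_div hv hperf] at hβα
    exact ⟨α, hα, β, hβE, hβ, hβα⟩
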